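/- (Interpolation error for QR pivot actuators.) Let n, r, q be natural numbers with 1 ≤ r < n and r ≤ q. Let Φ, Ψ ∈ ℝ^{n×r} and B ∈ ℝ^{n×q}, and suppose V := Bᵀ Φ ∈ ℝ^{q×r} has full column rank. Suppose Vᵀ = Φᵀ B admits a pivoted QR factorization (ΦᵀB) P̃ = Q̃ R̃ with P̃ a q×q permutation matrix, Q̃ ∈ ℝ^{r×r} orthogonal, and R̃ ∈ ℝ^{r×q} upper triangular satisfying the Businger–Golub diagonal dominance property. Let S_B ∈ ℝ^{q×r} consist of the first r columns of P̃, set B̂ := B S_B, and define P_B := Φ (B̂ᵀΦ)⁻¹ B̂ᵀ. Let z ∈ ℝⁿ, z⋆ := Φ Ψᵀ z, and suppose ‖z − z⋆‖₂ ≤ 2 Σ_{i=r+1}^{n} σᵢ for given nonnegative reals σ_{r+1}, …, σ_n. Then ‖z − P_B z‖₂ ≤ ( ‖Φ‖₂ ‖B‖₂ / σ_min(ΦᵀB) ) · √(q − r + 1) · ( √(4^r + 6r − 1) / 3 ) · 2 Σ_{i=r+1}^{n} σᵢ. -/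

import Mathlib

open Matrix

/-- Spectral norm (ℓ₂→ℓ₂ operator norm) of a real matrix. -/
noncomputable def specNorm {m n : ℕ} (M : Matrix (Fin m) (Fin n) ℝ) : ℝ :=
  ‖LinearMap.toContinuousLinearMap (Matrix.toEuclideanLin M)‖

/-- Euclidean norm of a vector in ℝⁿ. -/
noncomputable def euclNorm {n : ℕ} (x : Fin n → ℝ) : ℝ :=
  ‖(EuclideanSpace.equiv (Fin n) ℝ).symm x‖

/-- Smallest singular value of a matrix: the infimum of `‖Ux‖₂` over the unit sphere. -/
noncomputable def sigmaMin {p r : ℕ} (U : Matrix (Fin p) (Fin r) ℝ) : ℝ :=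
  sInf {c : ℝ | ∃ x : Fin r → ℝ, euclNorm x = 1 ∧ c = euclNorm (U.mulVec x)}

/-- A permutation matrix: exactly one entry 1 in each row and column, zeros elsewhere. -/
def IsPermMatrix {p : ℕ} (P : Matrix (Fin p) (Fin p) ℝ) : Prop :=
  ∃ σ : Equiv.Perm (Fin p), P = σ.permMatrix ℝ

/-- Upper triangular (possibly rectangular) matrix: `R j k = 0` for `j > k`. -/
def IsUpperTri {r p : ℕ} (R : Matrix (Fin r) (Fin p) ℝ) : Prop :=
  ∀ (j : Fin r) (k : Fin p), (k : ℕ) < (j : ℕ) → R j k = 0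

/-- Businger–Golub diagonal dominance:
`|R i i|² ≥ Σ_{j=i}^{min(k,r)} |R j k|²` for all `i ≤ k`. -/
def BusingerGolub {r p : ℕ} (R : Matrix (Fin r) (Fin p) ℝ) : Prop :=
  ∀ (i : Fin r) (ip : Fin p) (k : Fin p), (i : ℕ) = (ip : ℕ) → (ip : ℕ) ≤ (k : ℕ) →
    (∑ j : Fin r, if (i : ℕ) ≤ (j : ℕ) ∧ (j : ℕ) ≤ (k : ℕ) then (R j k) ^ 2 else 0)
      ≤ (R i ip) ^ 2

theorem sq_mul_add_le {A S b c : ℝ} (k : ℝ) (hc : 0 ≤ c) (hS : 0 ≤ S) (h : A ^ 2 ≤ c * S) :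
    (k * A + b) ^ 2 ≤ (k ^ 2 * c + 1) * (S + b ^ 2) := by
  have h1 : 2 * k * A * b ≤ k ^ 2 * c * b ^ 2 + S := by
    refine le_of_abs_le (abs_le_of_sq_le_sq ?_ (by positivity))
    have h2 : (k * b) ^ 2 * A ^ 2 ≤ (k * b) ^ 2 * (c * S) :=
      mul_le_mul_of_nonneg_left h (sq_nonneg _)
    nlinarith [sq_nonneg (k ^ 2 * c * b ^ 2 - S)]
  have h3 : k ^ 2 * A ^ 2 ≤ k ^ 2 * (c * S) := mul_le_mul_of_nonneg_left h (sq_nonneg _)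
  nlinarith

/-- A discrete Gronwall-type estimate for back substitution with unit upper triangular matrices
whose entries are bounded by one. -/
theorem sum_sq_le_of_le_add_sum_gt {m : ℕ} (a b : Fin m → ℝ) (ha : ∀ i, 0 ≤ a i)
    (hab : ∀ i, a i ≤ b i + ∑ j, if i < j then a j else 0) :
    (∑ i, a i) ^ 2 ≤ ((4 : ℝ) ^ m - 1) / 3 * ∑ i, b i ^ 2 ∧
      ∑ i, a i ^ 2 ≤ ((4 : ℝ) ^ m + 6 * m - 1) / 9 * ∑ i, b i ^ 2 := by
  induction m with
  | zero => simp
  | succ m ih =>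
    have htail := ih (fun i => a i.succ) (fun i => b i.succ) (fun i => ha _) (fun i => by
      have h := hab i.succ
      rw [Fin.sum_univ_succ] at h
      simpa using h)
    have h0 := hab 0
    rw [Fin.sum_univ_succ] at h0
    simp only [lt_self_iff_false, if_false, Fin.succ_pos, if_true, zero_add] at h0
    simp only [Fin.sum_univ_succ (n := m)]
    set A := ∑ i : Fin m, a i.succ
    set S := ∑ i : Fin m, b i.succ ^ 2
    set N := ∑ i : Fin m, a i.succ ^ 2
    have hA : 0 ≤ A := Finset.sum_nonneg fun i _ => ha _
    have hS : 0 ≤ S := Finset.sum_nonneg fun i _ => sq_nonneg _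
    have hp : (1 : ℝ) ≤ 4 ^ m := one_le_pow₀ (by norm_num)
    have hc : 0 ≤ ((4 : ℝ) ^ m - 1) / 3 := by linarith
    have ha0 := ha 0
    have h2 := sq_mul_add_le (b := b 0) 2 hc hS htail.1
    have h1 := sq_mul_add_le (b := b 0) 1 hc hS htail.1
    constructor
    · have : (a 0 + A) ^ 2 ≤ (2 * A + b 0) ^ 2 :=
        pow_le_pow_left₀ (by positivity) (by linarith) 2
      rw [pow_succ (4 : ℝ) m]
      nlinarith
    · have h3 : a 0 ^ 2 ≤ (1 * A + b 0) ^ 2 := pow_le_pow_left₀ ha0 (by linarith) 2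
      have h4 : ((4 : ℝ) ^ m + 6 * m - 1) / 9 * S ≤
          ((4 : ℝ) ^ m + 6 * m - 1) / 9 * (b 0 ^ 2 + S) := by
        apply mul_le_mul_of_nonneg_left (by nlinarith [sq_nonneg (b 0)])
        have : (0 : ℝ) ≤ m := by positivity
        linarith
      rw [pow_succ (4 : ℝ) m]
      push_cast
      nlinarith [htail.2]

theorem euclNorm_sq {n : ℕ} (x : Fin n → ℝ) : euclNorm x ^ 2 = ∑ i, x i ^ 2 := by
  simp [euclNorm, EuclideanSpace.norm_sq_eq]

theorem euclNorm_nonneg {n : ℕ} (x : Fin n → ℝ) : 0 ≤ euclNorm x := norm_nonneg _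

theorem euclNorm_mulVec_of_transpose_mul_self {m n : ℕ} {A : Matrix (Fin m) (Fin n) ℝ}
    (hA : Aᵀ * A = 1) (x : Fin n → ℝ) : euclNorm (A.mulVec x) = euclNorm x := by
  rw [← sq_eq_sq₀ (euclNorm_nonneg _) (euclNorm_nonneg _), euclNorm_sq, euclNorm_sq]
  have h : (A *ᵥ x) ⬝ᵥ (A *ᵥ x) = x ⬝ᵥ x := by
    rw [dotProduct_mulVec, ← mulVec_transpose, mulVec_mulVec, hA, one_mulVec]
  simpa [dotProduct, sq] using h

open scoped Matrix.Norms.L2Operator in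
theorem specNorm_eq_norm {m n : ℕ} (M : Matrix (Fin m) (Fin n) ℝ) : specNorm M = ‖M‖ := by
  rw [Matrix.l2_opNorm_def]
  rfl

theorem euclNorm_mulVec_le {m n : ℕ} (M : Matrix (Fin m) (Fin n) ℝ) (x : Fin n → ℝ) :
    euclNorm (M.mulVec x) ≤ specNorm M * euclNorm x :=
  (LinearMap.toContinuousLinearMap (Matrix.toEuclideanLin M)).le_opNorm
    ((EuclideanSpace.equiv (Fin n) ℝ).symm x)

theorem specNorm_nonneg {m n : ℕ} (M : Matrix (Fin m) (Fin n) ℝ) : 0 ≤ specNorm M :=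
  norm_nonneg _

theorem specNorm_le_of_euclNorm_mulVec_le {m n : ℕ} {M : Matrix (Fin m) (Fin n) ℝ} {C : ℝ}
    (hC : 0 ≤ C) (h : ∀ x, euclNorm (M.mulVec x) ≤ C * euclNorm x) : specNorm M ≤ C :=
  ContinuousLinearMap.opNorm_le_bound _ hC fun x => h x.ofLp

theorem specNorm_mul_le {l m n : ℕ} (A : Matrix (Fin l) (Fin m) ℝ)
    (B : Matrix (Fin m) (Fin n) ℝ) : specNorm (A * B) ≤ specNorm A * specNorm B := by
  simp only [specNorm_eq_norm]
  exact Matrix.l2_opNorm_mul A B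

theorem specNorm_transpose {m n : ℕ} (A : Matrix (Fin m) (Fin n) ℝ) :
    specNorm Aᵀ = specNorm A := by
  simp only [specNorm_eq_norm]
  exact Matrix.l2_opNorm_conjTranspose A

theorem specNorm_le_one_of_transpose_mul_self {m n : ℕ} {A : Matrix (Fin m) (Fin n) ℝ}
    (hA : Aᵀ * A = 1) : specNorm A ≤ 1 :=
  specNorm_le_of_euclNorm_mulVec_le zero_le_one fun x => by
    rw [euclNorm_mulVec_of_transpose_mul_self hA, one_mul]

/-- A bound for a nonzero (oblique) projector is also a bound for its complement. -/
theorem norm_sub_le_of_idempotent {E : Type*} [NormedAddCommGroup E] [InnerProductSpace ℝ E]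
    (P : E →ₗ[ℝ] E) (hP : ∀ x, P (P x) = P x) {y : E} (hy : P y ≠ 0) {C : ℝ}
    (hC : ∀ x, ‖P x‖ ≤ C * ‖x‖) (x : E) : ‖x - P x‖ ≤ C * ‖x‖ := by
  by_cases hu : x - P x = 0
  · rw [hu, norm_zero]
    exact (norm_nonneg _).trans (hC x)
  by_cases hv : P x = 0
  · have h1 : 1 ≤ C := by
      have h := hC (P y)
      rw [hP] at h
      have hpos : 0 < ‖P y‖ := norm_pos_iff.2 hy
      by_contra! hlt
      nlinarith
    rw [hv, sub_zero]
    nlinarith [norm_nonneg x]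
  set u := x - P x with hudef
  set v := P x with hvdef
  have hPu : P u = 0 := by rw [hudef, map_sub, hvdef, hP, sub_self]
  have hPv : P v = v := hP x
  have hx : x = u + v := by rw [hudef]; abel
  have hu' : 0 < ‖u‖ := norm_pos_iff.2 hu
  have hv' : 0 < ‖v‖ := norm_pos_iff.2 hv
  set w := (‖v‖ / ‖u‖) • u + (‖u‖ / ‖v‖) • v with hw
  have hPw : ‖P w‖ = ‖u‖ := by
    rw [hw, map_add, map_smul, map_smul, hPu, hPv, smul_zero, zero_add, norm_smul,
      Real.norm_of_nonneg (by positivity)]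
    field_simp
  have hwx : ‖w‖ = ‖x‖ := by
    rw [← sq_eq_sq₀ (norm_nonneg _) (norm_nonneg _), hx, hw, norm_add_sq_real, norm_add_sq_real,
      norm_smul, norm_smul, Real.norm_of_nonneg (by positivity),
      Real.norm_of_nonneg (by positivity), real_inner_smul_left, real_inner_smul_right]
    field_simp
    ring
  have h := hC w
  rwa [hPw, hwx] at h

theorem sigmaMin_le {p r : ℕ} (U : Matrix (Fin p) (Fin r) ℝ) {x : Fin r → ℝ}
    (hx : euclNorm x = 1) : sigmaMin U ≤ euclNorm (U.mulVec x) :=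
  csInf_le ⟨0, by rintro _ ⟨y, _, rfl⟩; exact euclNorm_nonneg _⟩ ⟨x, hx, rfl⟩

theorem sigmaMin_pos_of_rank_eq {p r : ℕ} (hr : 1 ≤ r) (U : Matrix (Fin p) (Fin r) ℝ)
    (hU : U.rank = r) : 0 < sigmaMin U := by
  have hinj : Function.Injective U.mulVec := by
    rw [Matrix.mulVec_injective_iff, linearIndependent_iff_card_eq_finrank_span, Set.finrank,
      ← Matrix.rank_eq_finrank_span_cols, hU, Fintype.card_fin]
  have hker : LinearMap.ker (Matrix.toEuclideanLin U) = ⊥ := by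
    rw [LinearMap.ker_eq_bot]
    intro x y hxy
    exact WithLp.ofLp_injective 2 (hinj (congrArg WithLp.ofLp hxy))
  obtain ⟨K, hK, hanti⟩ := LinearMap.exists_antilipschitzWith _ hker
  have hK' : (0 : ℝ) < K := hK
  refine lt_of_lt_of_le (inv_pos.2 hK') (le_csInf ?_ ?_)
  · refine ⟨_, Pi.single ⟨0, hr⟩ 1, ?_, rfl⟩
    rw [← sq_eq_sq₀ (euclNorm_nonneg _) zero_le_one, euclNorm_sq]
    simp [Pi.single_apply]
  · rintro _ ⟨x, hx, rfl⟩
    have h := hanti.le_mul_dist ((EuclideanSpace.equiv (Fin r) ℝ).symm x) 0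
    rw [map_zero, dist_zero_right, dist_zero_right] at h
    change euclNorm x ≤ K * euclNorm (U.mulVec x) at h
    rw [hx] at h
    rwa [inv_le_iff_one_le_mul₀' hK']

theorem BusingerGolub.sq_le {r q : ℕ} {R : Matrix (Fin r) (Fin q) ℝ} (hR : BusingerGolub R)
    {i j : Fin r} {l k : Fin q} (hil : (i : ℕ) = l) (hij : (i : ℕ) ≤ j) (hjk : (j : ℕ) ≤ k) :
    R j k ^ 2 ≤ R i l ^ 2 := by
  refine le_trans ?_ (hR i l k hil (by omega))
  refine le_trans ?_ (Finset.single_le_sum (fun j' _ => ?_) (Finset.mem_univ j))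
  · simp [hij, hjk]
  · split_ifs <;> positivity

/-- Back substitution estimate for the leading square block of a Businger–Golub factor. -/
theorem BusingerGolub.mul_euclNorm_le {r q : ℕ} (hrq : r ≤ q) {R : Matrix (Fin r) (Fin q) ℝ}
    (hR : BusingerGolub R) (htri : IsUpperTri R) {d : ℝ} (hd : 0 ≤ d)
    (hdiag : ∀ i, d ≤ |R i (Fin.castLE hrq i)|) (x : Fin r → ℝ) :
    d * euclNorm x ≤ Real.sqrt ((4 : ℝ) ^ r + 6 * r - 1) / 3 *
      euclNorm ((R.submatrix id (Fin.castLE hrq)).mulVec x) := by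
  set T := R.submatrix id (Fin.castLE hrq) with hT
  have hback : ∀ i, d * |x i| ≤ |(T.mulVec x) i| + ∑ j, if i < j then d * |x j| else 0 := by
    intro i
    rcases hd.eq_or_lt with rfl | hd
    · simp
    have hti : 0 < |T i i| := hd.trans_le (hdiag i)
    have hsum : T i i * x i = (T.mulVec x) i - ∑ j, if i < j then T i j * x j else 0 := by
      have h : (T.mulVec x) i = ∑ j, ((if j = i then T i i * x i else 0) +
          if i < j then T i j * x j else 0) := by
        simp only [mulVec, dotProduct]
        refine Finset.sum_congr rfl fun j _ => ?_
        rcases lt_trichotomy i j with h | rfl | h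
        · simp [h, h.ne']
        · simp
        · have : T i j = 0 := htri _ _ h
          simp [h.ne, h.not_gt, this]
      rw [h, Finset.sum_add_distrib, Finset.sum_ite_eq']
      simp
    have hle : |T i i| * |x i| ≤ |(T.mulVec x) i| + |T i i| * ∑ j, if i < j then |x j| else 0 := by
      rw [← abs_mul, hsum, Finset.mul_sum]
      refine (abs_sub _ _).trans (add_le_add le_rfl ?_)
      refine (Finset.abs_sum_le_sum_abs _ _).trans (Finset.sum_le_sum fun j _ => ?_)
      split_ifs with h
      · rw [abs_mul]
        exact mul_le_mul_of_nonneg_right (sq_le_sq.1 (hR.sq_le (l := Fin.castLE hrq i)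
          (k := Fin.castLE hrq j) rfl le_rfl (Fin.le_def.1 h.le))) (abs_nonneg _)
      · simp
    have hs : (∑ j, if i < j then d * |x j| else 0) = d * ∑ j, if i < j then |x j| else 0 := by
      rw [Finset.mul_sum]
      exact Finset.sum_congr rfl fun j _ => by split_ifs <;> simp
    rw [hs]
    set X := ∑ j, if i < j then |x j| else 0
    have hmul : |T i i| * (|x i| - X) ≤ |(T.mulVec x) i| := by linarith
    rcases le_total (|x i|) X with hX | hX
    · have := mul_le_mul_of_nonneg_left hX hd.le
      have := abs_nonneg ((T.mulVec x) i)
      linarith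
    · have := mul_le_mul_of_nonneg_right (hdiag i) (sub_nonneg.2 hX)
      have : d * (|x i| - X) ≤ |(T.mulVec x) i| := this.trans hmul
      linarith
  have hmain := (sum_sq_le_of_le_add_sum_gt (fun i => d * |x i|) (fun i => |(T.mulVec x) i|)
    (fun i => by positivity) hback).2
  simp only [mul_pow, sq_abs] at hmain
  rw [← Finset.mul_sum, ← euclNorm_sq, ← euclNorm_sq] at hmain
  have hp : (1 : ℝ) ≤ 4 ^ r := one_le_pow₀ (by norm_num)
  have hc : (0 : ℝ) ≤ 4 ^ r + 6 * r - 1 := by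
    have : (0 : ℝ) ≤ r := by positivity
    linarith
  have hx := euclNorm_nonneg x
  have hTx := euclNorm_nonneg (T.mulVec x)
  refine le_of_abs_le (abs_le_of_sq_le_sq ?_ (by positivity))
  rw [mul_pow, mul_pow, div_pow, Real.sq_sqrt hc]
  linarith

theorem IsPermMatrix.mul_transpose_self {p : ℕ} {P : Matrix (Fin p) (Fin p) ℝ}
    (hP : IsPermMatrix P) : P * Pᵀ = 1 := by
  obtain ⟨σ, rfl⟩ := hP
  rw [Matrix.transpose_permMatrix, ← Matrix.permMatrix_mul, inv_mul_cancel, Matrix.permMatrix_one]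

/-- The smallest singular value is controlled by the last diagonal entry of the factor. -/
theorem BusingerGolub.sigmaMin_le {r q : ℕ} (hr : 1 ≤ r) (hrq : r ≤ q)
    {V : Matrix (Fin q) (Fin r) ℝ} {P : Matrix (Fin q) (Fin q) ℝ} {Q : Matrix (Fin r) (Fin r) ℝ}
    {R : Matrix (Fin r) (Fin q) ℝ} (hR : BusingerGolub R) (htri : IsUpperTri R)
    (hP : P * Pᵀ = 1) (hQ : Qᵀ * Q = 1) (hQR : Vᵀ * P = Q * R) :
    sigmaMin V ≤ Real.sqrt ((q : ℝ) - r + 1) *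
      |R ⟨r - 1, by omega⟩ ⟨r - 1, by omega⟩| := by
  set l : Fin r := ⟨r - 1, by omega⟩
  set l' : Fin q := ⟨r - 1, by omega⟩
  have hV : V = P * (Rᵀ * Qᵀ) := by
    rw [← transpose_mul, ← hQR, transpose_mul, transpose_transpose, ← Matrix.mul_assoc, hP,
      Matrix.one_mul]
  have hVe : V.mulVec (Q.mulVec (Pi.single l 1)) = P.mulVec (R l) := by
    rw [hV, mulVec_mulVec, Matrix.mul_assoc, Matrix.mul_assoc, hQ, Matrix.mul_one,
      ← mulVec_mulVec, mulVec_single_one]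
    rfl
  have he : euclNorm (Q.mulVec (Pi.single l 1)) = 1 := by
    rw [euclNorm_mulVec_of_transpose_mul_self hQ, ← sq_eq_sq₀ (euclNorm_nonneg _) zero_le_one,
      euclNorm_sq]
    simp [Pi.single_apply]
  refine (_root_.sigmaMin_le V he).trans ?_
  rw [hVe, euclNorm_mulVec_of_transpose_mul_self (mul_eq_one_comm.1 hP)]
  have hq : (0 : ℝ) ≤ (q : ℝ) - r + 1 := by
    have : (r : ℝ) ≤ q := by exact_mod_cast hrq
    linarith
  refine le_of_abs_le (abs_le_of_sq_le_sq ?_ (by positivity))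
  rw [mul_pow, Real.sq_sqrt hq, sq_abs, euclNorm_sq]
  calc ∑ k, R l k ^ 2 ≤ ∑ k, if l' ≤ k then R l l' ^ 2 else 0 := by
        refine Finset.sum_le_sum fun k _ => ?_
        split_ifs with h
        · exact hR.sq_le rfl le_rfl (Fin.le_def.1 h)
        · rw [htri l k (Fin.lt_def.1 (not_le.1 h)), zero_pow two_ne_zero]
    _ = ((q : ℝ) - r + 1) * R l l' ^ 2 := by
        rw [← Finset.sum_filter, Finset.sum_const, nsmul_eq_mul, Finset.filter_le_eq_Ici,
          Fin.card_Ici, Nat.cast_sub (by omega)]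
        simp only [l', Nat.cast_sub hr]
        ring

/-- Interpolation error bound for QR pivot actuators, in terms of the discarded Hankel
singular values `σ_{r+1}, …, σ_n`.  Here `σ_min(ΦᵀB)` is expressed as
`sigmaMin (Bᵀ * Φ)`, the smallest singular value of the (tall) transpose `V = BᵀΦ`,
which equals the smallest singular value of `ΦᵀB`. -/
theorem interp_error_qr_actuators {n q r : ℕ} (hr : 1 ≤ r) (hrn : r < n) (hrq : r ≤ q)
    (Φ Ψ : Matrix (Fin n) (Fin r) ℝ) (B : Matrix (Fin n) (Fin q) ℝ)
    (hrank : (Bᵀ * Φ).rank = r)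
    (Pt : Matrix (Fin q) (Fin q) ℝ) (hP : IsPermMatrix Pt)
    (Qt : Matrix (Fin r) (Fin r) ℝ) (hQ : Qtᵀ * Qt = 1)
    (Rt : Matrix (Fin r) (Fin q) ℝ) (hRtri : IsUpperTri Rt) (hRbg : BusingerGolub Rt)
    (hQR : (Φᵀ * B) * Pt = Qt * Rt)
    (SB : Matrix (Fin q) (Fin r) ℝ)
    (hSB : SB = Matrix.of fun (j : Fin q) (i : Fin r) => Pt j (Fin.castLE hrq i))
    (Bhat : Matrix (Fin n) (Fin r) ℝ) (hBhat : Bhat = B * SB)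
    (PB : Matrix (Fin n) (Fin n) ℝ) (hPB : PB = Φ * (Bhatᵀ * Φ)⁻¹ * Bhatᵀ)
    (z zstar : Fin n → ℝ) (hzstar : zstar = Φ.mulVec (Ψᵀ.mulVec z))
    (σ : ℕ → ℝ) (hσ : ∀ i, r + 1 ≤ i → i ≤ n → 0 ≤ σ i)
    (hres : euclNorm (z - zstar) ≤ 2 * ∑ i ∈ Finset.Icc (r + 1) n, σ i) :
    euclNorm (z - PB.mulVec z) ≤
      (specNorm Φ * specNorm B / sigmaMin (Bᵀ * Φ)) *
        Real.sqrt ((q : ℝ) - r + 1) * (Real.sqrt ((4 : ℝ) ^ r + 6 * r - 1) / 3) *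
        (2 * ∑ i ∈ Finset.Icc (r + 1) n, σ i) := by
  have hPP := hP.mul_transpose_self
  have hpos := sigmaMin_pos_of_rank_eq hr _ hrank
  have hQR' : (Bᵀ * Φ)ᵀ * Pt = Qt * Rt := by rw [transpose_mul, transpose_transpose, hQR]
  have hsig := hRbg.sigmaMin_le hr hrq hRtri hPP hQ hQR'
  set s := sigmaMin (Bᵀ * Φ)
  set d := |Rt ⟨r - 1, by omega⟩ ⟨r - 1, by omega⟩|
  have hd : 0 < d := pos_of_mul_pos_right (hpos.trans_le hsig) (Real.sqrt_nonneg _)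
  set c := Real.sqrt ((4 : ℝ) ^ r + 6 * r - 1) / 3
  have hc : 0 ≤ c := by positivity
  set T := Rt.submatrix id (Fin.castLE hrq) with hT
  have hbs : ∀ x, d * euclNorm x ≤ c * euclNorm (T.mulVec x) :=
    hRbg.mul_euclNorm_le hrq hRtri hd.le fun i =>
      sq_le_sq.1 (hRbg.sq_le rfl (Nat.le_sub_one_of_lt i.2) le_rfl)
  have hTdet : IsUnit T.det := by
    have hTtri : ∀ i j : Fin r, j < i → T i j = 0 :=
      fun i j hij => hRtri i (Fin.castLE hrq j) hij
    rw [Matrix.det_of_isUpperTriangular (fun i j hij => hTtri i j hij), isUnit_iff_ne_zero,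
      Finset.prod_ne_zero_iff]
    intro i _ h0
    have h : d ≤ |T i i| := sq_le_sq.1 (hRbg.sq_le rfl (Nat.le_sub_one_of_lt i.2) le_rfl)
    rw [h0, abs_zero] at h
    linarith
  have hTinv : specNorm T⁻¹ ≤ c / d := by
    refine specNorm_le_of_euclNorm_mulVec_le (by positivity) fun y => ?_
    have h := hbs (T⁻¹.mulVec y)
    rw [mulVec_mulVec, Matrix.mul_nonsing_inv _ hTdet, one_mulVec] at h
    rw [div_mul_eq_mul_div, le_div_iff₀ hd]
    linarith
  have hSB' : SB = Pt.submatrix id (Fin.castLE hrq) := hSB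
  have hSBorth : SBᵀ * SB = 1 := by
    rw [hSB', transpose_submatrix, ← submatrix_mul Ptᵀ Pt _ id _ Function.bijective_id,
      mul_eq_one_comm.1 hPP, submatrix_one _ (Fin.castLE_injective hrq)]
  have hM : Bhatᵀ * Φ = Tᵀ * Qtᵀ := by
    have h : Φᵀ * B * SB = Qt * T := by
      rw [hSB', hT]
      exact congrArg (fun X => X.submatrix id (Fin.castLE hrq)) hQR
    rw [← transpose_mul, ← h, hBhat, Matrix.mul_assoc, transpose_mul _ (B * SB),
      transpose_transpose]
  have hleft : Qt * T⁻¹ᵀ * (Bhatᵀ * Φ) = 1 := by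
    rw [hM, Matrix.mul_assoc, ← Matrix.mul_assoc T⁻¹ᵀ, ← transpose_mul,
      Matrix.mul_nonsing_inv _ hTdet, transpose_one, Matrix.one_mul, mul_eq_one_comm.1 hQ]
  have hMinv : (Bhatᵀ * Φ)⁻¹ = Qt * T⁻¹ᵀ := Matrix.inv_eq_left_inv hleft
  have hPBΦ : PB * Φ = Φ := by
    rw [hPB, Matrix.mul_assoc, Matrix.mul_assoc, hMinv, hleft, Matrix.mul_one]
  have hPBidem : PB * PB = PB := by
    nth_rewrite 2 [hPB]
    rw [← Matrix.mul_assoc, ← Matrix.mul_assoc, hPBΦ, ← hPB]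
  have hBhatnorm : specNorm Bhat ≤ specNorm B := by
    rw [hBhat]
    exact (specNorm_mul_le _ _).trans (mul_le_of_le_one_right (specNorm_nonneg _)
      (specNorm_le_one_of_transpose_mul_self hSBorth))
  have hPBnorm : specNorm PB ≤ specNorm Φ * (c / d) * specNorm B := by
    have h1 : specNorm (Bhatᵀ * Φ)⁻¹ ≤ c / d := by
      rw [hMinv]
      refine (specNorm_mul_le _ _).trans ?_
      rw [specNorm_transpose]
      exact (mul_le_of_le_one_left (specNorm_nonneg _)
        (specNorm_le_one_of_transpose_mul_self hQ)).trans hTinv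
    rw [hPB]
    refine (specNorm_mul_le _ _).trans ?_
    rw [specNorm_transpose]
    have := specNorm_nonneg Φ
    have := specNorm_nonneg Bhat
    gcongr
    refine (specNorm_mul_le _ _).trans ?_
    gcongr
  have hΦ : Φ ≠ 0 := by
    rintro rfl
    rw [Matrix.mul_zero, Matrix.rank_zero] at hrank
    omega
  obtain ⟨x, hx⟩ : ∃ x, Φ.mulVec x ≠ 0 := by
    by_contra! h
    exact hΦ (Matrix.ext_of_mulVec_single fun i => by rw [h, zero_mulVec])
  have hPBz : z - PB.mulVec z = (z - zstar) - PB.mulVec (z - zstar) := by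
    rw [mulVec_sub, hzstar, mulVec_mulVec (Ψᵀ *ᵥ z), hPBΦ]
    abel
  have hcompl : euclNorm (z - PB.mulVec z) ≤ specNorm PB * euclNorm (z - zstar) := by
    rw [hPBz]
    refine norm_sub_le_of_idempotent (Matrix.toEuclideanLin PB) (fun y => ?_)
      (y := WithLp.toLp 2 (Φ.mulVec x)) ?_ (fun y => euclNorm_mulVec_le PB y.ofLp)
      (WithLp.toLp 2 (z - zstar))
    · apply WithLp.ofLp_injective 2
      change PB.mulVec (PB.mulVec y.ofLp) = PB.mulVec y.ofLp
      rw [mulVec_mulVec, hPBidem]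
    · intro h
      have h' : PB.mulVec (Φ.mulVec x) = 0 := congrArg WithLp.ofLp h
      rw [mulVec_mulVec, hPBΦ] at h'
      exact hx h'
  have hdinv : d⁻¹ ≤ Real.sqrt ((q : ℝ) - r + 1) / s := by
    rw [inv_le_iff_one_le_mul₀ hd, div_mul_eq_mul_div, one_le_div hpos]
    exact hsig
  have hC : specNorm PB ≤ specNorm Φ * specNorm B / s * Real.sqrt ((q : ℝ) - r + 1) * c := by
    refine hPBnorm.trans ?_
    have := specNorm_nonneg Φ
    have := specNorm_nonneg B
    calc specNorm Φ * (c / d) * specNorm B = specNorm Φ * specNorm B * c * d⁻¹ := by ring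
      _ ≤ specNorm Φ * specNorm B * c * (Real.sqrt ((q : ℝ) - r + 1) / s) := by gcongr
      _ = _ := by ring
  exact hcompl.trans (mul_le_mul hC hres (euclNorm_nonneg _) ((specNorm_nonneg _).trans hC))
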